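/- arXiv:1512.02078 — 2 statements merged into one kernel-verified Lean document; each statement's English description precedes it below -/
import Mathlib

section
/- Let G be a perfect information game, M an epistemic model w.r.t. G, F⊗(M) the run model generated by repeatedly updating the observation model U, and f the induced state assignment function. Then f is a p-morphism from F⊗(M) to the induced epistemic game structure E(G) (viewed as an epistemic temporal model). -/
namespace GameRuns

/-- An observation model: an equivalence relation on actions for each player. -/
structure ObsModel (I A : Type) where
  rel : I → A → A → Prop
  equiv : ∀ i, Equivalence (rel i)

/-- The data of a game structure: a partial transition function and game information. -/
structure GameData (I A P S : Type) where
  R : S → A → Option S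
  O : S → I → Set P

/-- `G` is a game structure w.r.t. the player assignment `pl` and the
distinguished information pieces `pa`. -/
def IsGameStructure {I A P S : Type} (pl : A → I) (pa : A → P) (G : GameData I A P S) : Prop :=
  Nonempty S ∧
  (∀ s a b, (G.R s a).isSome → (G.R s b).isSome → pl a = pl b) ∧
  (∀ s a, pa a ∈ G.O s (pl a) ↔ (G.R s a).isSome)

/-- The data of an epistemic model w.r.t. a game structure over states `S`. -/
structure EpiData (I A P S : Type) (W : Type) where
  f : W → S
  sim : I → W → W → Prop
  V : W → I → Set P

/-- `M` is an epistemic model w.r.t. the game structure `G`. -/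
def IsEpiModel {I A P S W : Type} (G : GameData I A P S) (M : EpiData I A P S W) : Prop :=
  Nonempty W ∧
  (∀ i, Equivalence (M.sim i)) ∧
  (∀ i w v, M.sim i w v → G.O (M.f w) i = G.O (M.f v) i) ∧
  (∀ w i, M.V w i = G.O (M.f w) i)

variable {I A P S : Type}

/-- Carrier of the update product `M ⊗ U`. -/
abbrev UpdW (G : GameData I A P S) {W : Type} (M : EpiData I A P S W) : Type :=
  {x : W × A // (G.R (M.f x.1) x.2).isSome}

/-- The update product `M ⊗ U`. -/
def update (G : GameData I A P S) (U : ObsModel I A) {W : Type} (M : EpiData I A P S W) :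
    EpiData I A P S (UpdW G M) where
  f x := (G.R (M.f x.val.1) x.val.2).get x.prop
  sim i x y := M.sim i x.val.1 y.val.1 ∧ U.rel i x.val.2 y.val.2 ∧
    G.O ((G.R (M.f x.val.1) x.val.2).get x.prop) i =
      G.O ((G.R (M.f y.val.1) y.val.2).get y.prop) i
  V x i := G.O ((G.R (M.f x.val.1) x.val.2).get x.prop) i

/-- The data of an epistemic temporal model. -/
structure ETLData (I A P : Type) (W : Type) where
  sim : I → W → W → Prop
  trans : A → W → W → Prop
  V : W → I → Set P

/-- `N` is an epistemic temporal model: nonempty carrier, equivalence relations. -/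
def IsETL {W : Type} (N : ETLData I A P W) : Prop :=
  Nonempty W ∧ ∀ i, Equivalence (N.sim i)

/-- The set of actions available at a state of an epistemic temporal model. -/
def Act {W : Type} (N : ETLData I A P W) (s : W) : Set A := {a | ∃ t, N.trans a s t}

/-- Normality of an epistemic temporal model w.r.t. an observation model:
no miracles, perfect recall, determinism, exclusive turns, info and knowledge of
own information. -/
def Normal (pl : A → I) (pa : A → P) (U : ObsModel I A) {W : Type}
    (N : ETLData I A P W) : Prop :=
  (∀ i a b s s' t t', N.sim i s s' → N.trans a s' t' → N.trans b s t →
      U.rel i b a → N.V t i = N.V t' i → N.sim i t t') ∧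
  (∀ i a s t t', N.trans a s t → N.sim i t t' →
      ∃ s' b, N.sim i s s' ∧ U.rel i a b ∧ N.trans b s' t') ∧
  (∀ a s t t', N.trans a s t → N.trans a s t' → t = t') ∧
  (∀ s : W, (Act N s).Nonempty → ∃ j, ∀ a ∈ Act N s, pl a = j) ∧
  (∀ s a, pa a ∈ N.V s (pl a) ↔ ∃ t, N.trans a s t) ∧
  (∀ i w v, N.sim i w v → N.V w i = N.V v i)

/-- A bundled epistemic model (carrier together with the model). -/
structure BEpi (I A P S : Type) where
  W : Type
  M : EpiData I A P S W

/-- Bundled update. -/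
def bUpdate (G : GameData I A P S) (U : ObsModel I A) (B : BEpi I A P S) : BEpi I A P S :=
  ⟨UpdW G B.M, update G U B.M⟩

/-- Iterated update `M ⊗ U^k`. -/
def iter (G : GameData I A P S) (U : ObsModel I A) (B : BEpi I A P S) : ℕ → BEpi I A P S
  | 0 => B
  | k + 1 => bUpdate G U (iter G U B k)

/-- Carrier of the run model generated by repeatedly updating `U`:
states of level `k` are the states of `M ⊗ U^k`. -/
abbrev RunW (G : GameData I A P S) (U : ObsModel I A) (B : BEpi I A P S) : Type :=
  Σ k : ℕ, (iter G U B k).W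

/-- The successor state `(w, a)` of `w` in the next level of the run model. -/
def stepUp (G : GameData I A P S) (U : ObsModel I A) (B : BEpi I A P S) (k : ℕ)
    (w : (iter G U B k).W) (a : A) (h : (G.R ((iter G U B k).M.f w) a).isSome) :
    (iter G U B (k + 1)).W :=
  ⟨(w, a), h⟩

/-- Epistemic relation of the run model. -/
def runSim (G : GameData I A P S) (U : ObsModel I A) (B : BEpi I A P S) (i : I) :
    RunW G U B → RunW G U B → Prop := fun x y =>
  ∃ h : x.1 = y.1,
    (iter G U B y.1).M.sim i (cast (congrArg (fun k => (iter G U B k).W) h) x.2) y.2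

/-- Action relation of the run model. -/
def runTrans (G : GameData I A P S) (U : ObsModel I A) (B : BEpi I A P S) (a : A) :
    RunW G U B → RunW G U B → Prop := fun x y =>
  ∃ h : (G.R ((iter G U B x.1).M.f x.2) a).isSome,
    y = ⟨x.1 + 1, stepUp G U B x.1 x.2 a h⟩

/-- The run model `F⊗(M)` generated by repeatedly updating `U`. -/
def runModel (G : GameData I A P S) (U : ObsModel I A) (B : BEpi I A P S) :
    ETLData I A P (RunW G U B) where
  sim := runSim G U B
  trans := runTrans G U B
  V x i := (iter G U B x.1).M.V x.2 i

/-- The induced state assignment function of the run model. -/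
def runF (G : GameData I A P S) (U : ObsModel I A) (B : BEpi I A P S) :
    RunW G U B → S := fun x => (iter G U B x.1).M.f x.2



section More
variable {I A P S : Type}

/-- The state reached by following a list of actions from `s`, if it exists. -/
def runPath (G : GameData I A P S) : S → List A → Option S
  | s, [] => some s
  | s, a :: l => (G.R s a).bind fun t => runPath G t l

theorem runPath_append (G : GameData I A P S) (s : S) (l : List A) (a : A) :
    runPath G s (l ++ [a]) = (runPath G s l).bind fun t => G.R t a := by
  induction l generalizing s with
  | nil => simp [runPath]
  | cons b l ih =>
    simp only [List.cons_append, runPath]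
    cases h : G.R s b with
    | none => simp
    | some t => simp [ih]

/-- The initial world and the sequence of actions of a state of the run model. -/
def runActs (G : GameData I A P S) (U : ObsModel I A) (B : BEpi I A P S) :
    (k : ℕ) → (iter G U B k).W → B.W × List A
  | 0, w => (w, [])
  | k + 1, w =>
      ((runActs G U B k w.val.1).1, (runActs G U B k w.val.1).2 ++ [w.val.2])

theorem runActs_path (G : GameData I A P S) (U : ObsModel I A) (B : BEpi I A P S) :
    ∀ (k : ℕ) (w : (iter G U B k).W),
      runPath G (B.M.f (runActs G U B k w).1) (runActs G U B k w).2 =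
        some ((iter G U B k).M.f w) := by
  intro k
  induction k with
  | zero => intro w; rfl
  | succ k ih =>
    intro w
    have h1 := ih w.val.1
    show runPath G _ _ = some ((update G U (iter G U B k).M).f w)
    rw [show runActs G U B (k + 1) w =
        ((runActs G U B k w.val.1).1, (runActs G U B k w.val.1).2 ++ [w.val.2]) from rfl]
    rw [runPath_append, h1]
    exact (Option.some_get w.prop).symm

/-- Carrier of the epistemic game tree generatedfrom `s`: valid histories. -/
abbrev TreeW (G : GameData I A P S) (s : S) : Type := {l : List A // (runPath G s l).isSome}

/-- The epistemic game tree generated from `s` with perfect recall,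
viewed as an epistemic temporal model. -/
def tree (G : GameData I A P S) (s : S) : ETLData I A P (TreeW G s) where
  sim i w u := w.val.length = u.val.length ∧
    ∀ k, (runPath G s (w.val.take k)).map (fun t => G.O t i) =
      (runPath G s (u.val.take k)).map (fun t => G.O t i)
  trans a w u := u.val = w.val ++ [a]
  V w i := G.O ((runPath G s w.val).get w.prop) i

/-- The tracking function from the run model of a certainty epistemic model to the
epistemic game tree generated from the (common-knowledge) initial state. -/
def tracking (G : GameData I A P S) (U : ObsModel I A) {W : Type} (M : EpiData I A P S W)
    (v : W) (hv : ∀ x : W, x = v) (x : RunW G U ⟨W, M⟩) : TreeW G (M.f v) :=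
  ⟨(runActs G U ⟨W, M⟩ x.1 x.2).2, by
    have h : runPath G (M.f (runActs G U ⟨W, M⟩ x.1 x.2).1)
        (runActs G U ⟨W, M⟩ x.1 x.2).2 = some ((iter G U ⟨W, M⟩ x.1).M.f x.2) :=
      runActs_path G U ⟨W, M⟩ x.1 x.2
    rw [hv (runActs G U ⟨W, M⟩ x.1 x.2).1] at h
    rw [h]
    rfl⟩

/-- `U` is non-informative w.r.t. an epistemic temporal model. -/
def NonInformative (U : ObsModel I A) {W : Type} (N : ETLData I A P W) : Prop :=
  ∀ i a b w u s t, N.trans a w s → N.trans b u t → N.sim i w u →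
    ¬ U.rel i a b → N.V s i ≠ N.V t i

/-- Isomorphism of epistemic temporal models. -/
def IsIso {W W' : Type} (N : ETLData I A P W) (N' : ETLData I A P W') (g : W → W') : Prop :=
  Function.Bijective g ∧
  (∀ i x y, N.sim i x y ↔ N'.sim i (g x) (g y)) ∧
  (∀ a x y, N.trans a x y ↔ N'.trans a (g x) (g y)) ∧
  (∀ x i, N.V x i = N'.V (g x) i)

/-- p-morphisms between epistemic temporal models. -/
def IsPMorphism {W W' : Type} (N : ETLData I A P W) (N' : ETLData I A P W')
    (g : W → W') : Prop :=
  (∀ w i, N.V w i = N'.V (g w) i) ∧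
  (∀ i w u, N.sim i w u → N'.sim i (g w) (g u)) ∧
  (∀ i w s, N'.sim i (g w) s → ∃ v, g v = s ∧ N.sim i w v) ∧
  (∀ a w u, N.trans a w u → N'.trans a (g w) (g u)) ∧
  (∀ a w s, N'.trans a (g w) s → ∃ v, g v = s ∧ N.trans a w v)

/-- The induced epistemic game structure `E(G)`, viewed as an epistemic temporal model. -/
def egame (G : GameData I A P S) : ETLData I A P S where
  sim i s t := G.O s i = G.O t i
  trans a s t := G.R s a = some t
  V s i := G.O s i

/-- `G` is a perfect information game: the induced epistemic relations are the identity. -/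
def PerfectInfo (G : GameData I A P S) : Prop :=
  ∀ i s t, G.O s i = G.O t i → s = t

/-- The game induced by an epistemic temporal model: `R(s,a) = t` iff `s →_a t`. -/
noncomputable def inducedGame {W : Type} (N : ETLData I A P W) : GameData I A P W where
  R s a := @dite _ (∃ t, N.trans a s t) (Classical.propDecidable _)
    (fun h => some h.choose) (fun _ => none)
  O := N.V

/-- The epistemic part induced by an epistemic temporal model. -/
def epiPart {W : Type} (N : ETLData I A P W) : EpiData I A P W W where
  f := id
  sim := N.sim
  V := N.V

theorem inducedGame_isSome {W : Type} (N : ETLData I A P W) {a : A} {s t : W}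
    (h : N.trans a s t) : ((inducedGame N).R s a).isSome := by
  show (@dite _ (∃ t, N.trans a s t) (Classical.propDecidable _)
    (fun h => some h.choose) (fun _ => none)).isSome
  rw [dif_pos ⟨t, h⟩]
  rfl

end More
section Lang
variable {I A P S : Type}

/-- The dynamic epistemic language LDEL. -/
inductive LDEL (I A P : Type) : Type where
  | top : LDEL I A P
  | atom : P → I → LDEL I A P
  | neg : LDEL I A P → LDEL I A P
  | conj : LDEL I A P → LDEL I A P → LDEL I A P
  | know : I → LDEL I A P → LDEL I A P
  | box : A → LDEL I A P → LDEL I A P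

/-- Implication, defined from negation and conjunction. -/
def impF (φ ψ : LDEL I A P) : LDEL I A P := .neg (.conj φ (.neg ψ))

/-- Disjunction. -/
def orF (φ ψ : LDEL I A P) : LDEL I A P := .neg (.conj (.neg φ) (.neg ψ))

/-- Biconditional. -/
def iffF (φ ψ : LDEL I A P) : LDEL I A P := .conj (impF φ ψ) (impF ψ φ)

/-- Diamond `⟨a⟩φ`. -/
def diaF (a : A) (φ : LDEL I A P) : LDEL I A P := .neg (.box a (.neg φ))

/-- The dual knowledge modality `K̂_i φ`. -/
def khatF (i : I) (φ : LDEL I A P) : LDEL I A P := .neg (.know i (.neg φ))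

/-- Finite conjunction. -/
def bigAnd : List (LDEL I A P) → LDEL I A P
  | [] => .top
  | φ :: l => .conj φ (bigAnd l)

/-- Finite disjunction. -/
def bigOr : List (LDEL I A P) → LDEL I A P
  | [] => .neg .top
  | φ :: l => orF φ (bigOr l)

/-- The characteristic formula `φ^o_i` of a combination of information pieces,
where `L1` enumerates the pieces in `B` and `L2` those not in `B`. -/
def charF (i : I) (L1 L2 : List P) : LDEL I A P :=
  .conj (bigAnd (L1.map (fun p => LDEL.atom p i)))
    (bigAnd (L2.map (fun p => LDEL.neg (LDEL.atom p i))))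

/-- `TURN_i`, given an enumeration `l` of the actions of player `i`. -/
def turnF (l : List A) : LDEL I A P := bigOr (l.map (fun a => diaF a LDEL.top))

/-- Propositional evaluation treating atoms, `K_i ψ` and `[a]ψ` as atomic. -/
def propEval (v : LDEL I A P → Prop) : LDEL I A P → Prop
  | .top => True
  | .neg φ => ¬ propEval v φ
  | .conj φ ψ => propEval v φ ∧ propEval v ψ
  | φ => v φ

/-- The dynamic (DEL-style) semantics `⊨` over epistemic models w.r.t. a game structure. -/
def dynSat (G : GameData I A P S) (U : ObsModel I A) :
    LDEL I A P → (W : Type) → EpiData I A P S W → W → Prop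
  | .top, _, _, _ => True
  | .atom p i, _, M, w => p ∈ M.V w i
  | .neg φ, W, M, w => ¬ dynSat G U φ W M w
  | .conj φ ψ, W, M, w => dynSat G U φ W M w ∧ dynSat G U ψ W M w
  | .know i φ, W, M, w => ∀ v, M.sim i w v → dynSat G U φ W M v
  | .box a φ, _, M, w => ∀ h : (G.R (M.f w) a).isSome,
      dynSat G U φ (UpdW G M) (update G U M) ⟨(w, a), h⟩

/-- The epistemic temporal (ETL-style) semantics `⊩`. -/
def etlSat {W : Type} (N : ETLData I A P W) : LDEL I A P → W → Prop
  | .top, _ => True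
  | .atom p i, w => p ∈ N.V w i
  | .neg φ, w => ¬ etlSat N φ w
  | .conj φ ψ, w => etlSat N φ w ∧ etlSat N ψ w
  | .know i φ, w => ∀ v, N.sim i w v → etlSat N φ v
  | .box a φ, w => ∀ v, N.trans a w v → etlSat N φ v

/-- `Z` is a `G`-bisimulation between two epistemic models w.r.t. `G`. -/
def IsGBisim {W W' : Type} (G : GameData I A P S) (M : EpiData I A P S W)
    (N : EpiData I A P S W') (Z : W → W' → Prop) : Prop :=
  ∀ w u, Z w u →
    M.f w = N.f u ∧
    (∀ i w', M.sim i w w' → ∃ u', N.sim i u u' ∧ Z w' u') ∧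
    (∀ i u', N.sim i u u' → ∃ w', M.sim i w w' ∧ Z w' u')

/-- Pointed `G`-bisimilarity. -/
def GBisimilar {W W' : Type} (G : GameData I A P S) (M : EpiData I A P S W)
    (N : EpiData I A P S W') (w : W) (u : W') : Prop :=
  ∃ Z, IsGBisim G M N Z ∧ Z w u

/-- The proof system SIG. -/
inductive SIG (pl : A → I) (pa : A → P) (U : ObsModel I A) : LDEL I A P → Prop where
  | taut {φ : LDEL I A P} : (∀ v, propEval v φ) → SIG pl pa U φ
  | distK (i : I) (φ ψ : LDEL I A P) :
      SIG pl pa U (impF (.know i (impF φ ψ)) (impF (.know i φ) (.know i ψ)))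
  | distB (a : A) (φ ψ : LDEL I A P) :
      SIG pl pa U (impF (.box a (impF φ ψ)) (impF (.box a φ) (.box a ψ)))
  | axT (i : I) (φ : LDEL I A P) : SIG pl pa U (impF (.know i φ) φ)
  | ax4 (i : I) (φ : LDEL I A P) :
      SIG pl pa U (impF (.know i φ) (.know i (.know i φ)))
  | ax5 (i : I) (φ : LDEL I A P) :
      SIG pl pa U (impF (.neg (.know i φ)) (.know i (.neg (.know i φ))))
  | nm (i : I) (a b : A) (φ : LDEL I A P) (B : Set P) (L1 L2 : List P)
      (h1 : ∀ p, p ∈ L1 ↔ p ∈ B) (h2 : ∀ p, p ∈ L2 ↔ p ∉ B) (hab : U.rel i a b) :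
      SIG pl pa U (impF (khatF i (diaF b (.conj φ (charF i L1 L2))))
        (.box a (impF (charF i L1 L2) (khatF i φ))))
  | pr (i : I) (a : A) (φ : LDEL I A P) (L : List A) (hL : ∀ b, b ∈ L ↔ U.rel i a b) :
      SIG pl pa U (impF (diaF a (khatF i φ))
        (bigOr (L.map (fun b => khatF i (diaF b φ)))))
  | det (a : A) (φ : LDEL I A P) : SIG pl pa U (impF (diaF a φ) (.box a φ))
  | exturn (i : I) (LA : I → List A) (hLA : ∀ j a, a ∈ LA j ↔ pl a = j)
      (LI : List I) (hLI : ∀ j, j ∈ LI ↔ j ≠ i) :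
      SIG pl pa U (impF (turnF (LA i))
        (bigAnd (LI.map (fun j => LDEL.neg (turnF (LA j))))))
  | info (a : A) : SIG pl pa U (iffF (diaF a .top) (.atom (pa a) (pl a)))
  | ke (p : P) (i : I) :
      SIG pl pa U (.conj (impF (.atom p i) (.know i (.atom p i)))
        (impF (.neg (.atom p i)) (.know i (.neg (.atom p i)))))
  | mp {φ ψ : LDEL I A P} : SIG pl pa U (impF φ ψ) → SIG pl pa U φ → SIG pl pa U ψ
  | necK (i : I) {φ : LDEL I A P} : SIG pl pa U φ → SIG pl pa U (.know i φ)
  | necB (a : A) {φ : LDEL I A P} : SIG pl pa U φ → SIG pl pa U (.box a φ)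

/-- A set of formulas is SIG-inconsistent if the negation of the conjunction of some
finite list of its members is derivable. -/
def Inconsistent (pl : A → I) (pa : A → P) (U : ObsModel I A)
    (Γ : Set (LDEL I A P)) : Prop :=
  ∃ L : List (LDEL I A P), (∀ φ ∈ L, φ ∈ Γ) ∧ SIG pl pa U (.neg (bigAnd L))

/-- Maximally SIG-consistent sets. -/
def MCS (pl : A → I) (pa : A → P) (U : ObsModel I A) (Γ : Set (LDEL I A P)) : Prop :=
  ¬ Inconsistent pl pa U Γ ∧ ∀ Δ, Γ ⊂ Δ → Inconsistent pl pa U Δ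

/-- Carrier of the canonical model: all maximally consistent sets. -/
abbrev CanW (pl : A → I) (pa : A → P) (U : ObsModel I A) : Type :=
  {Γ : Set (LDEL I A P) // MCS pl pa U Γ}

/-- The canonical model of SIG. -/
def canonical (pl : A → I) (pa : A → P) (U : ObsModel I A) :
    ETLData I A P (CanW pl pa U) where
  sim i w u := ∀ φ, LDEL.know i φ ∈ w.val → φ ∈ u.val
  trans a w u := ∀ φ, LDEL.box a φ ∈ w.val → φ ∈ u.val
  V w i := {p | LDEL.atom p i ∈ w.val}

end Lang

section Statements
variable {I A P S W W' : Type}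

/-- The epistemic relations of every iterated update of an epistemic model are reflexive. -/
theorem iter_sim_refl {G : GameData I A P S} (U : ObsModel I A) {M : EpiData I A P S W}
    (hM : IsEpiModel G M) (i : I) :
    ∀ (k : ℕ) (w : (iter G U ⟨W, M⟩ k).W), (iter G U ⟨W, M⟩ k).M.sim i w w
  | 0, w => (hM.2.1 i).refl w
  | k + 1, w => ⟨iter_sim_refl U hM i k w.val.1, (U.equiv i).refl _, rfl⟩

/-- Related worlds of an iterated update carry the same game information. -/
theorem obs_eq_of_iter_sim {G : GameData I A P S} (U : ObsModel I A) {M : EpiData I A P S W}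
    (hM : IsEpiModel G M) (i : I) :
    ∀ (k : ℕ) (w v : (iter G U ⟨W, M⟩ k).W), (iter G U ⟨W, M⟩ k).M.sim i w v →
      G.O ((iter G U ⟨W, M⟩ k).M.f w) i = G.O ((iter G U ⟨W, M⟩ k).M.f v) i
  | 0, w, v, h => hM.2.2.1 i w v h
  | _ + 1, _, _, h => h.2.2

/-- The valuation of an iterated update is the game information of the assigned state. -/
theorem iter_V {G : GameData I A P S} (U : ObsModel I A) {M : EpiData I A P S W}
    (hM : IsEpiModel G M) (i : I) :
    ∀ (k : ℕ) (w : (iter G U ⟨W, M⟩ k).W),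
      (iter G U ⟨W, M⟩ k).M.V w i = G.O ((iter G U ⟨W, M⟩ k).M.f w) i
  | 0, w => hM.2.2.2 w i
  | _ + 1, _ => rfl

theorem statement3 [Fintype I] [Fintype A] [Fintype P] [Nonempty I] [Nonempty A]
    (pl : A → I) (pa : A → P) (U : ObsModel I A)
    (G : GameData I A P S) (hG : IsGameStructure pl pa G) (hpi : PerfectInfo G)
    (M : EpiData I A P S W) (hM : IsEpiModel G M) :
    IsPMorphism (runModel G U ⟨W, M⟩) (egame G) (runF G U ⟨W, M⟩) := by
  refine ⟨fun w i => iter_V U hM i w.1 w.2, ?_, ?_, ?_, ?_⟩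
  · rintro i ⟨k, w⟩ ⟨j, u⟩ ⟨h, hs⟩
    obtain rfl : k = j := h
    exact obs_eq_of_iter_sim U hM i k w u hs
  · intro i w s hs
    exact ⟨w, hpi i _ _ hs, rfl, iter_sim_refl U hM i w.1 w.2⟩
  · rintro a w _ ⟨h, rfl⟩
    exact (Option.some_get h).symm
  · intro a w s hs
    have hs' : G.R ((iter G U ⟨W, M⟩ w.1).M.f w.2) a = some s := hs
    have h : (G.R ((iter G U ⟨W, M⟩ w.1).M.f w.2) a).isSome := by rw [hs']; rfl
    exact ⟨⟨w.1 + 1, stepUp G U ⟨W, M⟩ w.1 w.2 a h⟩, Option.get_of_eq_some h hs', h, rfl⟩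

end Statements
end GameRuns
end

section
/- Let N = (W, ∼, →, V) be a normal epistemic temporal model w.r.t. U, let G = G_N be the game induced by N and let M = M_N be the epistemic part induced by N. Then for every LDEL formula φ and every s ∈ W: N, s ⊩ φ if and only if M, s ⊨ φ. -/
namespace GameRuns

variable {I A P S : Type}

section Statements
variable {I A P S W W' : Type}

theorem inducedGame_trans_get (N : ETLData I A P W) {a : A} {s : W}
    (h : ((inducedGame N).R s a).isSome) :
    N.trans a s (((inducedGame N).R s a).get h) := by
  by_cases ht : ∃ t, N.trans a s t
  · simpa [inducedGame, ht] using ht.choose_spec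
  · simp [inducedGame, ht] at h

/-- The state assignment of `M` is a p-morphism into `N` with respect to the epistemic relations
and the valuation. -/
structure Tracks (N : ETLData I A P W) (M : EpiData I A P W W') : Prop where
  val : ∀ w i, M.V w i = N.V (M.f w) i
  forth : ∀ i w v, M.sim i w v → N.sim i (M.f w) (M.f v)
  back : ∀ i w t, N.sim i (M.f w) t → ∃ v, M.sim i w v ∧ M.f v = t

theorem tracks_epiPart (N : ETLData I A P W) : Tracks N (epiPart N) where
  val _ _ := rfl
  forth _ _ _ h := h
  back _ _ t h := ⟨t, h, rfl⟩

theorem Tracks.update {pl : A → I} {pa : A → P} {U : ObsModel I A} {N : ETLData I A P W}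
    (hn : Normal pl pa U N) {M : EpiData I A P W W'} (hM : Tracks N M) :
    Tracks N (update (inducedGame N) U M) where
  val _ _ := rfl
  forth i x y h :=
    hn.1 i _ _ _ _ _ _ (hM.forth i _ _ h.1) (inducedGame_trans_get N y.prop)
      (inducedGame_trans_get N x.prop) h.2.1 h.2.2
  back i x t h := by
    obtain ⟨-, hrecall, det, -, -, ke⟩ := hn
    obtain ⟨s, b, hs, hb, ht⟩ := hrecall i _ _ _ t (inducedGame_trans_get N x.prop) h
    obtain ⟨v, hv, rfl⟩ := hM.back i _ s hs
    have hsome := inducedGame_isSome N ht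
    have hget := det _ _ _ _ (inducedGame_trans_get N hsome) ht
    refine ⟨⟨(v, b), hsome⟩, ⟨hv, hb, ?_⟩, hget⟩
    exact (ke i _ _ h).trans (congrArg (fun u => N.V u i) hget.symm)

theorem Tracks.etlSat_iff_dynSat {pl : A → I} {pa : A → P} {U : ObsModel I A}
    {N : ETLData I A P W} (hn : Normal pl pa U N) (φ : LDEL I A P)
    {M : EpiData I A P W W'} (hM : Tracks N M) (w : W') :
    etlSat N φ (M.f w) ↔ dynSat (inducedGame N) U φ W' M w := by
  induction φ generalizing W' with
  | top => exact Iff.rfl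
  | atom p i => simp only [etlSat, dynSat, hM.val]
  | neg φ ih => exact not_congr (ih hM w)
  | conj φ ψ ihφ ihψ => exact and_congr (ihφ hM w) (ihψ hM w)
  | know i φ ih =>
    refine ⟨fun h v hv => (ih hM v).1 (h _ (hM.forth i w v hv)), fun h t ht => ?_⟩
    obtain ⟨v, hv, rfl⟩ := hM.back i w t ht
    exact (ih hM v).2 (h v hv)
  | box a φ ih =>
    refine ⟨fun h hsome => (ih (hM.update hn) _).1 (h _ (inducedGame_trans_get N hsome)),
      fun h t ht => ?_⟩
    have hsome := inducedGame_isSome N ht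
    rw [← hn.2.2.1 _ _ _ _ (inducedGame_trans_get N hsome) ht]
    exact (ih (hM.update hn) _).2 (h hsome)

theorem statement10 [Fintype I] [Fintype A] [Fintype P] [Nonempty I] [Nonempty A]
    (pl : A → I) (pa : A → P) (U : ObsModel I A)
    (N : ETLData I A P W) (hetl : IsETL N) (hn : Normal pl pa U N)
    (φ : LDEL I A P) (s : W) :
    etlSat N φ s ↔ dynSat (inducedGame N) U φ W (epiPart N) s :=
  (tracks_epiPart N).etlSat_iff_dynSat hn φ s

end Statements
end GameRuns
end
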